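/- Let X ∈ ℝ^{n×d}, let L ∈ ℝ^{n×n} be symmetric positive semidefinite, let μ > 0 with Xᵀ L X ≠ 0, and let β > 0. Define f(W,H) = (1/2)‖X − X W H‖_F² + (μ/2)Tr(Wᵀ Xᵀ L X W) and g_β(W) = β·Σ_{i=1}^d ‖W_{i·}‖₂, where W_{i·} is the i-th row of W ∈ ℝ^{d×K} and H ∈ ℝ^{K×d}. Let (W^k, H^k), k ≥ 0, be sequences with every W^k entrywise nonnegative such that for every k: (i) W^{k+1} minimizes, over entrywise nonnegative W ∈ ℝ^{d×K}, the function W ↦ Tr(G_kᵀ(W − W^k)) + (L_w^k/2)‖W − W^k‖_F² + g_β(W), where G_k = Xᵀ(X W^k H^k − X)(H^k)ᵀ + μ Xᵀ L X W^k and L_w^k = ‖H^k(H^k)ᵀ‖₂‖XᵀX‖₂ + μ‖Xᵀ L X‖₂; and (ii) H^{k+1} minimizes H ↦ f(W^{k+1}, H) over ℝ^{K×d}. Then for every limit point (W̄, H̄) of the sequence {(W^k,H^k)}: (a) (X W̄)ᵀ(X W̄ H̄ − X) = 0; and (b) W̄ minimizes, over entrywise nonnegative W ∈ ℝ^{d×K},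 the function W ↦ Tr(Ḡᵀ(W − W̄)) + (L̄/2)‖W − W̄‖_F² + g_β(W), where Ḡ = Xᵀ(X W̄ H̄ − X)H̄ᵀ + μ Xᵀ L X W̄ and L̄ = ‖H̄ H̄ᵀ‖₂‖XᵀX‖₂ + μ‖Xᵀ L X‖₂. -/

import Mathlib

open scoped BigOperators
open Matrix Filter Topology

/-- Squared Frobenius norm of a matrix. -/
noncomputable def frobSq {m p : Type*} [Fintype m] [Fintype p]
    (A : Matrix m p ℝ) : ℝ :=
  ∑ i, ∑ j, (A i j) ^ 2

/-- Frobenius norm of a matrix. -/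
noncomputable def frobNorm {m p : Type*} [Fintype m] [Fintype p]
    (A : Matrix m p ℝ) : ℝ :=
  Real.sqrt (frobSq A)

/-- Spectral norm (largest singular value) of a matrix: its operator norm as a
linear map between Euclidean spaces. -/
noncomputable def specNorm {m p : ℕ} (A : Matrix (Fin m) (Fin p) ℝ) : ℝ :=
  ‖LinearMap.toContinuousLinearMap (Matrix.toEuclideanLin A)‖

/-- The smooth part of the GLoSS objective:
`f(W,H) = (1/2)‖X − XWH‖_F² + (μ/2)Tr(WᵀXᵀLXW)`. -/
noncomputable def fobj {n d K : ℕ} (X : Matrix (Fin n) (Fin d) ℝ)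
    (L : Matrix (Fin n) (Fin n) ℝ) (μ : ℝ)
    (W : Matrix (Fin d) (Fin K) ℝ) (H : Matrix (Fin K) (Fin d) ℝ) : ℝ :=
  (1 / 2) * frobSq (X - X * W * H) + (μ / 2) * Matrix.trace (Wᵀ * Xᵀ * L * X * W)

/-- The group-lasso regularizer `g_β(W) = β Σᵢ ‖Wᵢ·‖₂` (sum of Euclidean norms of rows). -/
noncomputable def gbeta {d K : ℕ} (β : ℝ) (W : Matrix (Fin d) (Fin K) ℝ) : ℝ :=
  β * ∑ i, Real.sqrt (∑ j, (W i j) ^ 2)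

/-- The partial gradient `∇_W f(W,H) = Xᵀ(XWH − X)Hᵀ + μXᵀLXW`. -/
noncomputable def Gmat {n d K : ℕ} (X : Matrix (Fin n) (Fin d) ℝ)
    (L : Matrix (Fin n) (Fin n) ℝ) (μ : ℝ)
    (W : Matrix (Fin d) (Fin K) ℝ) (H : Matrix (Fin K) (Fin d) ℝ) :
    Matrix (Fin d) (Fin K) ℝ :=
  Xᵀ * (X * W * H - X) * Hᵀ + μ • (Xᵀ * L * X * W)

/-- The Lipschitz constant `L_w = ‖HHᵀ‖₂‖XᵀX‖₂ + μ‖XᵀLX‖₂`. -/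
noncomputable def Lw {n d K : ℕ} (X : Matrix (Fin n) (Fin d) ℝ)
    (L : Matrix (Fin n) (Fin n) ℝ) (μ : ℝ) (H : Matrix (Fin K) (Fin d) ℝ) : ℝ :=
  specNorm (H * Hᵀ) * specNorm (Xᵀ * X) + μ * specNorm (Xᵀ * L * X)

/-- The prox-linearized surrogate minimized at each `W`-update:
`W' ↦ ⟨∇_W f(Wk,Hk), W' − Wk⟩ + (L_w/2)‖W' − Wk‖_F² + g_β(W')`. -/
noncomputable def Qsurr {n d K : ℕ} (X : Matrix (Fin n) (Fin d) ℝ)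
    (L : Matrix (Fin n) (Fin n) ℝ) (μ β : ℝ)
    (Wk : Matrix (Fin d) (Fin K) ℝ) (Hk : Matrix (Fin K) (Fin d) ℝ)
    (W' : Matrix (Fin d) (Fin K) ℝ) : ℝ :=
  Matrix.trace ((Gmat X L μ Wk Hk)ᵀ * (W' - Wk)) +
    (Lw X L μ Hk / 2) * frobSq (W' - Wk) + gbeta β W'

section Auxiliary

variable {m p : Type*} [Fintype m] [Fintype p]

lemma frobSq_eq_trace (A : Matrix m p ℝ) : frobSq A = (Aᵀ * A).trace := by
  simp only [frobSq, Matrix.trace, Matrix.diag, Matrix.mul_apply, Matrix.transpose_apply]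
  rw [Finset.sum_comm]
  simp only [sq]

lemma frobSq_nonneg (A : Matrix m p ℝ) : 0 ≤ frobSq A :=
  Finset.sum_nonneg fun _ _ => Finset.sum_nonneg fun _ _ => sq_nonneg _

lemma sq_apply_le_frobSq (A : Matrix m p ℝ) (i : m) (j : p) : A i j ^ 2 ≤ frobSq A :=
  (Finset.single_le_sum (f := fun j => A i j ^ 2) (fun _ _ => sq_nonneg _)
    (Finset.mem_univ j)).trans
    (Finset.single_le_sum (f := fun i => ∑ j, A i j ^ 2)
      (fun _ _ => Finset.sum_nonneg fun _ _ => sq_nonneg _) (Finset.mem_univ i))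

lemma eq_zero_of_frobSq_eq_zero {A : Matrix m p ℝ} (h : frobSq A = 0) : A = 0 := by
  ext i j
  have := sq_apply_le_frobSq A i j
  rw [h] at this
  exact pow_eq_zero_iff two_ne_zero |>.mp (le_antisymm this (sq_nonneg _))

lemma frobSq_transpose (A : Matrix m p ℝ) : frobSq Aᵀ = frobSq A := by
  simp only [frobSq, Matrix.transpose_apply]
  exact Finset.sum_comm

lemma frobSq_smul (c : ℝ) (A : Matrix m p ℝ) : frobSq (c • A) = c ^ 2 * frobSq A := by
  simp [frobSq, mul_pow, Finset.mul_sum]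

lemma frobSq_neg (A : Matrix m p ℝ) : frobSq (-A) = frobSq A := by
  simp [frobSq]

lemma frobSq_add (A B : Matrix m p ℝ) :
    frobSq (A + B) = frobSq A + 2 * (Aᵀ * B).trace + frobSq B := by
  have h : (Bᵀ * A).trace = (Aᵀ * B).trace := by
    rw [← Matrix.trace_transpose (Bᵀ * A)]
    simp
  simp only [frobSq_eq_trace, Matrix.transpose_add, Matrix.add_mul, Matrix.mul_add,
    Matrix.trace_add, h]
  ring

end Auxiliary

lemma specNorm_nonneg {m p : ℕ} (A : Matrix (Fin m) (Fin p) ℝ) : 0 ≤ specNorm A :=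
  norm_nonneg _

lemma specNorm_pos {m p : ℕ} {A : Matrix (Fin m) (Fin p) ℝ} (h : A ≠ 0) : 0 < specNorm A := by
  unfold specNorm
  rw [norm_pos_iff]
  simpa using h

lemma continuous_specNorm {m p : ℕ} :
    Continuous (specNorm : Matrix (Fin m) (Fin p) ℝ → ℝ) := by
  let T : Matrix (Fin m) (Fin p) ℝ →ₗ[ℝ] (EuclideanSpace ℝ (Fin p) →L[ℝ] EuclideanSpace ℝ (Fin m)) :=
    LinearMap.toContinuousLinearMap.toLinearMap ∘ₗ Matrix.toEuclideanLin.toLinearMap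
  exact (LinearMap.continuous_of_finiteDimensional T).norm

lemma trace_quadratic_le {m p : ℕ} (M : Matrix (Fin m) (Fin m) ℝ) (D : Matrix (Fin m) (Fin p) ℝ) :
    (Dᵀ * M * D).trace ≤ specNorm M * frobSq D := by
  have hcol (j : Fin p) : (Dᵀ * M * D) j j ≤ specNorm M * ∑ i, D i j ^ 2 := by
    set T := LinearMap.toContinuousLinearMap (Matrix.toEuclideanLin M) with hT
    set v : EuclideanSpace ℝ (Fin m) := WithLp.toLp 2 fun i => D i j with hv
    have h1 : (Dᵀ * M * D) j j = inner ℝ v (T v) := by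
      rw [Matrix.mul_assoc]
      simp [hT, hv, Matrix.toEuclideanLin, Matrix.mul_apply, PiLp.inner_apply, Matrix.mulVec,
        dotProduct, mul_comm]
    have h2 : ∑ i, D i j ^ 2 = ‖v‖ ^ 2 := by
      simp [EuclideanSpace.norm_sq_eq, hv]
    rw [h1, h2]
    calc inner ℝ v (T v) ≤ ‖v‖ * ‖T v‖ := real_inner_le_norm _ _
      _ ≤ ‖v‖ * (‖T‖ * ‖v‖) := by gcongr; exact T.le_opNorm v
      _ = specNorm M * ‖v‖ ^ 2 := by rw [specNorm]; ring
  calc (Dᵀ * M * D).trace ≤ ∑ j, specNorm M * ∑ i, D i j ^ 2 := Finset.sum_le_sum fun j _ => hcol j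
    _ = specNorm M * frobSq D := by rw [← Finset.mul_sum, frobSq, Finset.sum_comm]

lemma frobSq_mul_mul_le {n d K e : ℕ} (X : Matrix (Fin n) (Fin d) ℝ)
    (D : Matrix (Fin d) (Fin K) ℝ) (H : Matrix (Fin K) (Fin e) ℝ) :
    frobSq (X * D * H) ≤ specNorm (H * Hᵀ) * specNorm (Xᵀ * X) * frobSq D := by
  have h1 : frobSq (X * D * H) ≤ specNorm (Xᵀ * X) * frobSq (D * H) := by
    refine le_of_eq_of_le ?_ (trace_quadratic_le (Xᵀ * X) (D * H))
    simp [frobSq_eq_trace, Matrix.mul_assoc]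
  have h2 : frobSq (D * H) ≤ specNorm (H * Hᵀ) * frobSq D := by
    rw [← frobSq_transpose (D * H), ← frobSq_transpose D]
    refine le_of_eq_of_le ?_ (trace_quadratic_le (H * Hᵀ) Dᵀ)
    simp [frobSq_eq_trace, Matrix.mul_assoc]
  calc frobSq (X * D * H) ≤ specNorm (Xᵀ * X) * (specNorm (H * Hᵀ) * frobSq D) :=
        h1.trans (mul_le_mul_of_nonneg_left h2 (specNorm_nonneg _))
    _ = _ := by ring

lemma gbeta_nonneg {d K : ℕ} {β : ℝ} (hβ : 0 ≤ β) (W : Matrix (Fin d) (Fin K) ℝ) :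
    0 ≤ gbeta β W :=
  mul_nonneg hβ (Finset.sum_nonneg fun _ _ => Real.sqrt_nonneg _)

lemma continuous_gbeta {d K : ℕ} (β : ℝ) :
    Continuous (gbeta β : Matrix (Fin d) (Fin K) ℝ → ℝ) := by
  unfold gbeta
  fun_prop

lemma gbeta_midpoint_le {d K : ℕ} {β : ℝ} (hβ : 0 ≤ β) (A B : Matrix (Fin d) (Fin K) ℝ) :
    gbeta β ((1 / 2 : ℝ) • (A + B)) ≤ 1 / 2 * (gbeta β A + gbeta β B) := by
  have hrow (C : Matrix (Fin d) (Fin K) ℝ) (i : Fin d) :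
      Real.sqrt (∑ j, C i j ^ 2) = ‖(WithLp.toLp 2 (C i) : EuclideanSpace ℝ (Fin K))‖ := by
    simp [EuclideanSpace.norm_eq]
  simp only [gbeta, hrow]
  rw [← mul_add, ← Finset.sum_add_distrib, mul_left_comm, Finset.mul_sum _ _ (1 / 2 : ℝ)]
  refine mul_le_mul_of_nonneg_left (Finset.sum_le_sum fun i _ => ?_) hβ
  have : (WithLp.toLp 2 (((1 / 2 : ℝ) • (A + B)) i) : EuclideanSpace ℝ (Fin K)) =
      (1 / 2 : ℝ) • (WithLp.toLp 2 (A i) + WithLp.toLp 2 (B i)) := rfl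
  rw [this, norm_smul, Real.norm_of_nonneg (by norm_num)]
  gcongr
  exact norm_add_le _ _

section Objective

variable {n d K : ℕ} {X : Matrix (Fin n) (Fin d) ℝ} {L : Matrix (Fin n) (Fin n) ℝ} {μ β : ℝ}

lemma fobj_nonneg (hL : L.PosSemidef) (hμ : 0 ≤ μ)
    (W : Matrix (Fin d) (Fin K) ℝ) (H : Matrix (Fin K) (Fin d) ℝ) : 0 ≤ fobj X L μ W H := by
  have h := (hL.conjTranspose_mul_mul_same (X * W)).trace_nonneg
  have h' : (Wᵀ * Xᵀ * L * X * W).trace = ((X * W)ᴴ * L * (X * W)).trace := by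
    simp [Matrix.conjTranspose_eq_transpose_of_trivial, Matrix.mul_assoc]
  have := frobSq_nonneg (X - X * W * H)
  unfold fobj
  rw [h']
  positivity

lemma fobj_add_le (hL : L.IsHermitian) (hμ : 0 ≤ μ)
    (W D : Matrix (Fin d) (Fin K) ℝ) (H : Matrix (Fin K) (Fin d) ℝ) :
    fobj X L μ (W + D) H ≤
      fobj X L μ W H + ((Gmat X L μ W H)ᵀ * D).trace + Lw X L μ H / 2 * frobSq D := by
  have hLt : Lᵀ = L := by
    simpa [Matrix.conjTranspose_eq_transpose_of_trivial] using hL.eq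
  have hfit : frobSq (X - X * (W + D) * H) = frobSq (X - X * W * H) +
      2 * ((Xᵀ * (X * W * H - X) * Hᵀ)ᵀ * D).trace + frobSq (X * D * H) := by
    have h1 : X - X * (W + D) * H = -((X * W * H - X) + X * D * H) := by
      rw [Matrix.mul_add, Matrix.add_mul]; abel
    have h2 : X - X * W * H = -(X * W * H - X) := by abel
    rw [h1, h2, frobSq_neg, frobSq_neg, frobSq_add]
    have h3 : ((X * W * H - X)ᵀ * (X * D * H)).trace =
        ((Xᵀ * (X * W * H - X) * Hᵀ)ᵀ * D).trace := by
      rw [← Matrix.mul_assoc, Matrix.trace_mul_comm]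
      simp only [Matrix.transpose_mul, Matrix.transpose_transpose, Matrix.mul_assoc]
    rw [h3]
  have hreg : ((W + D)ᵀ * Xᵀ * L * X * (W + D)).trace = (Wᵀ * Xᵀ * L * X * W).trace +
      2 * ((Xᵀ * L * X * W)ᵀ * D).trace + (Dᵀ * (Xᵀ * L * X) * D).trace := by
    have h1 : (Dᵀ * (Xᵀ * (L * (X * W)))).trace = (Wᵀ * (Xᵀ * (L * (X * D)))).trace := by
      rw [← Matrix.trace_transpose]
      simp [Matrix.transpose_mul, Matrix.mul_assoc, hLt]
    simp only [Matrix.transpose_add, Matrix.add_mul, Matrix.mul_add, Matrix.trace_add,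
      Matrix.transpose_mul, Matrix.transpose_transpose, Matrix.mul_assoc, hLt, h1]
    ring
  have hG : ((Gmat X L μ W H)ᵀ * D).trace = ((Xᵀ * (X * W * H - X) * Hᵀ)ᵀ * D).trace +
      μ * ((Xᵀ * L * X * W)ᵀ * D).trace := by
    rw [Gmat, Matrix.transpose_add, Matrix.add_mul, Matrix.trace_add, Matrix.transpose_smul,
      Matrix.smul_mul, Matrix.trace_smul, smul_eq_mul]
  have hq1 := frobSq_mul_mul_le X D H
  have hq2 := mul_le_mul_of_nonneg_left (trace_quadratic_le (Xᵀ * L * X) D) hμ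
  rw [fobj, fobj, Lw, hfit, hreg, hG]
  linarith

lemma Lw_ge (H : Matrix (Fin K) (Fin d) ℝ) : μ * specNorm (Xᵀ * L * X) ≤ Lw X L μ H :=
  le_add_of_nonneg_left (mul_nonneg (specNorm_nonneg _) (specNorm_nonneg _))

lemma objective_sufficient_decrease (hL : L.IsHermitian) (hμ : 0 ≤ μ) (hβ : 0 ≤ β)
    {W V : Matrix (Fin d) (Fin K) ℝ} {H : Matrix (Fin K) (Fin d) ℝ}
    (hW : ∀ i j, 0 ≤ W i j) (hV : ∀ i j, 0 ≤ V i j)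
    (hmin : ∀ W' : Matrix (Fin d) (Fin K) ℝ, (∀ i j, 0 ≤ W' i j) →
      Qsurr X L μ β W H V ≤ Qsurr X L μ β W H W') :
    fobj X L μ V H + gbeta β V + μ * specNorm (Xᵀ * L * X) / 4 * frobSq (V - W) ≤
      fobj X L μ W H + gbeta β W := by
  have hmid := hmin ((1 / 2 : ℝ) • (V + W)) fun i j => by
    have := hW i j
    have := hV i j
    simp only [Matrix.smul_apply, Matrix.add_apply, smul_eq_mul]
    positivity
  have hdiff : (1 / 2 : ℝ) • (V + W) - W = (1 / 2 : ℝ) • (V - W) := by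
    ext i j
    simp only [Matrix.sub_apply, Matrix.smul_apply, Matrix.add_apply, smul_eq_mul]
    ring
  have hf := fobj_add_le (X := X) hL hμ W (V - W) H
  rw [add_sub_cancel] at hf
  have hg := gbeta_midpoint_le hβ V W
  have hc := mul_le_mul_of_nonneg_right (Lw_ge (X := X) (L := L) (μ := μ) H)
    (frobSq_nonneg (V - W))
  simp only [Qsurr, hdiff, frobSq_smul, Matrix.mul_smul, Matrix.trace_smul, smul_eq_mul] at hmid
  linarith

lemma normal_equation_of_fobj_min {W : Matrix (Fin d) (Fin K) ℝ} {H : Matrix (Fin K) (Fin d) ℝ}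
    (hmin : ∀ H' : Matrix (Fin K) (Fin d) ℝ, fobj X L μ W H ≤ fobj X L μ W H') :
    (X * W)ᵀ * (X * W * H - X) = 0 := by
  set R := X * W * H - X with hR
  set E := (X * W)ᵀ * R with hE
  have hexp (t : ℝ) : frobSq (X - X * W * (H + t • E)) =
      frobSq (X - X * W * H) + 2 * (t * frobSq E) + t ^ 2 * frobSq (X * W * E) := by
    have h1 : X - X * W * (H + t • E) = -(R + t • (X * W * E)) := by
      rw [Matrix.mul_add, Matrix.mul_smul, hR]; abel
    have h2 : X - X * W * H = -R := by rw [hR]; abel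
    have h3 : (Rᵀ * (X * W * E)).trace = frobSq E := by
      rw [frobSq_eq_trace, ← Matrix.mul_assoc]
      congr 2
      rw [hE, Matrix.transpose_mul, Matrix.transpose_transpose]
    rw [h1, h2, frobSq_neg, frobSq_neg, frobSq_add, frobSq_smul, Matrix.mul_smul,
      Matrix.trace_smul, h3, smul_eq_mul]
  have hdisc := discrim_le_zero (a := frobSq (X * W * E)) (b := 2 * frobSq E) (c := 0) fun t => by
    have h := hmin (H + t • E)
    simp only [fobj, hexp t] at h
    linarith
  refine eq_zero_of_frobSq_eq_zero ?_
  simp only [discrim] at hdisc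
  nlinarith [sq_nonneg (frobSq E)]

lemma continuous_Qsurr :
    Continuous fun q : Matrix (Fin d) (Fin K) ℝ × Matrix (Fin K) (Fin d) ℝ ×
      Matrix (Fin d) (Fin K) ℝ => Qsurr X L μ β q.1 q.2.1 q.2.2 := by
  have h1 := continuous_specNorm (m := K) (p := K)
  have h2 := continuous_gbeta (d := d) (K := K) β
  have h3 : Continuous (frobSq : Matrix (Fin d) (Fin K) ℝ → ℝ) := by
    unfold frobSq
    fun_prop
  have h4 : Continuous fun q : Matrix (Fin d) (Fin K) ℝ × Matrix (Fin K) (Fin d) ℝ ×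
      Matrix (Fin d) (Fin K) ℝ => Gmat X L μ q.1 q.2.1 := by
    unfold Gmat
    fun_prop
  have h5 : Continuous (Lw X L μ : Matrix (Fin K) (Fin d) ℝ → ℝ) := by
    unfold Lw
    fun_prop
  unfold Qsurr
  fun_prop

end Objective

lemma tendsto_zero_of_add_le {F e : ℕ → ℝ} (hF : ∀ k, 0 ≤ F k) (he : ∀ k, 0 ≤ e k)
    (h : ∀ k, F (k + 1) + e k ≤ F k) : Tendsto e atTop (𝓝 0) := by
  have hanti : Antitone F := antitone_nat_of_succ_le fun k => by linarith [h k, he k]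
  have hlim := tendsto_atTop_ciInf hanti ⟨0, by rintro _ ⟨k, rfl⟩; exact hF k⟩
  have hdiff := hlim.sub (hlim.comp (tendsto_add_atTop_nat 1))
  rw [sub_self] at hdiff
  exact squeeze_zero he (fun k => by simpa using (by linarith [h k] : e k ≤ F k - F (k + 1))) hdiff

lemma tendsto_zero_of_frobSq {m p : Type*} [Fintype m] [Fintype p] {D : ℕ → Matrix m p ℝ}
    (h : Tendsto (fun k => frobSq (D k)) atTop (𝓝 0)) : Tendsto D atTop (𝓝 0) := by
  refine tendsto_pi_nhds.mpr fun i => tendsto_pi_nhds.mpr fun j => ?_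
  have hsq : Tendsto (fun k => D k i j ^ 2) atTop (𝓝 0) :=
    squeeze_zero (fun _ => sq_nonneg _) (fun k => sq_apply_le_frobSq (D k) i j) h
  have habs := hsq.sqrt
  simp only [Real.sqrt_sq_eq_abs, Real.sqrt_zero] at habs
  exact (tendsto_zero_iff_abs_tendsto_zero _).mpr habs

/-- iterate subsequence convergence: along the GLoSS block
coordinate descent iterations (without extrapolation), every limit point
`(W̄, H̄)` is a critical point: (a) `(XW̄)ᵀ(XW̄H̄ − X) = 0`, i.e. `H̄` solves its
subproblem, and (b) `W̄` minimizes its own prox-linearized subproblem over the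
nonnegative orthant. -/
theorem gloss_subsequence_convergence (n d K : ℕ)
    (X : Matrix (Fin n) (Fin d) ℝ) (L : Matrix (Fin n) (Fin n) ℝ)
    (hL : L.PosSemidef) (μ : ℝ) (hμ : 0 < μ) (hXLX : Xᵀ * L * X ≠ 0)
    (β : ℝ) (hβ : 0 < β)
    (W : ℕ → Matrix (Fin d) (Fin K) ℝ) (H : ℕ → Matrix (Fin K) (Fin d) ℝ)
    (hWnn : ∀ k, ∀ i j, 0 ≤ W k i j)
    (hWmin : ∀ k, ∀ W' : Matrix (Fin d) (Fin K) ℝ, (∀ i j, 0 ≤ W' i j) →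
      Qsurr X L μ β (W k) (H k) (W (k + 1)) ≤ Qsurr X L μ β (W k) (H k) W')
    (hHmin : ∀ k, ∀ H' : Matrix (Fin K) (Fin d) ℝ,
      fobj X L μ (W (k + 1)) (H (k + 1)) ≤ fobj X L μ (W (k + 1)) H')
    (Wbar : Matrix (Fin d) (Fin K) ℝ) (Hbar : Matrix (Fin K) (Fin d) ℝ)
    (hlim : ∃ φ : ℕ → ℕ, StrictMono φ ∧
      Tendsto (fun m => W (φ m)) atTop (𝓝 Wbar) ∧
      Tendsto (fun m => H (φ m)) atTop (𝓝 Hbar)) :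
    (X * Wbar)ᵀ * (X * Wbar * Hbar - X) = 0 ∧
    (∀ i j, 0 ≤ Wbar i j) ∧
    (∀ W' : Matrix (Fin d) (Fin K) ℝ, (∀ i j, 0 ≤ W' i j) →
      Qsurr X L μ β Wbar Hbar Wbar ≤ Qsurr X L μ β Wbar Hbar W') := by
  obtain ⟨φ, hφ, hWφ, hHφ⟩ := hlim
  have hc : 0 < μ * specNorm (Xᵀ * L * X) / 4 := by
    have := specNorm_pos hXLX
    positivity
  have hstep : Tendsto (fun k => W (k + 1) - W k) atTop (𝓝 0) := by
    refine tendsto_zero_of_frobSq ?_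
    have h := tendsto_zero_of_add_le
      (F := fun k => fobj X L μ (W k) (H k) + gbeta β (W k))
      (e := fun k => μ * specNorm (Xᵀ * L * X) / 4 * frobSq (W (k + 1) - W k))
      (fun k => add_nonneg (fobj_nonneg hL hμ.le _ _) (gbeta_nonneg hβ.le _))
      (fun k => mul_nonneg hc.le (frobSq_nonneg _))
      (fun k => by
        have h1 := objective_sufficient_decrease hL.isHermitian hμ.le hβ.le (hWnn k)
          (hWnn (k + 1)) (hWmin k)
        have h2 := hHmin k (H k)
        linarith)
    have h' := h.const_mul (μ * specNorm (Xᵀ * L * X) / 4)⁻¹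
    simpa only [inv_mul_cancel_left₀ hc.ne', mul_zero] using h'
  have hWφ' : Tendsto (fun m => W (φ m + 1)) atTop (𝓝 Wbar) := by
    have h := hWφ.add (hstep.comp hφ.tendsto_atTop)
    simpa using h
  refine ⟨?_, fun i j => ?_, fun W' hW' => ?_⟩
  · have hcont : Continuous fun q : Matrix (Fin d) (Fin K) ℝ × Matrix (Fin K) (Fin d) ℝ =>
        (X * q.1)ᵀ * (X * q.1 * q.2 - X) := by fun_prop
    have h := (hcont.tendsto (Wbar, Hbar)).comp (hWφ.prodMk_nhds hHφ)
    refine tendsto_nhds_unique_of_eventuallyEq h tendsto_const_nhds ?_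
    filter_upwards [eventually_ge_atTop 1] with m hm
    obtain ⟨k, hk⟩ := Nat.exists_eq_add_of_le' (hm.trans (hφ.le_apply (x := m)))
    simpa [hk] using normal_equation_of_fobj_min (hHmin k)
  · exact ge_of_tendsto' ((tendsto_pi_nhds.mp (tendsto_pi_nhds.mp hWφ i)) j)
      fun m => hWnn (φ m) i j
  · have hQ := continuous_Qsurr (X := X) (L := L) (μ := μ) (β := β) (K := K)
    exact le_of_tendsto_of_tendsto'
      ((hQ.tendsto (Wbar, Hbar, Wbar)).comp (hWφ.prodMk_nhds (hHφ.prodMk_nhds hWφ')))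
      ((hQ.tendsto (Wbar, Hbar, W')).comp (hWφ.prodMk_nhds (hHφ.prodMk_nhds tendsto_const_nhds)))
      fun m => hWmin (φ m) W' hW'
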